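/- arXiv:1602.07541 — 8 statements merged into one kernel-verified Lean document; each statement's English description precedes it below -/
import Mathlib

section
/- Every partial category action of a small category G on a set X admits a universal globalization: there exist a set Y equipped with a global category action of G and a G-function i : X → Y such that for every set Z with a global category action of G and every G-function j : X → Z there is a unique G-function k : Y → Z with j = k ∘ i. -/
universe u v w

/-- A small category presented in "morphisms-only" style: `M` is the set of
morphisms, objects are identified with their identity morphisms (the predicate
`obj`), `src`/`tgt` give the domain/codomain (as identity morphisms), and `mul`
is composition (its value is only relevant on composable pairs, i.e. those
`(g, h)` with `src g = tgt h`). -/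
structure PartialCat (M : Type u) where
  src : M → M
  tgt : M → M
  mul : M → M → M
  obj : M → Prop
  obj_src : ∀ g, obj (src g)
  obj_tgt : ∀ g, obj (tgt g)
  src_obj : ∀ e, obj e → src e = e
  tgt_obj : ∀ e, obj e → tgt e = e
  src_mul : ∀ g h, src g = tgt h → src (mul g h) = src h
  tgt_mul : ∀ g h, src g = tgt h → tgt (mul g h) = tgt g
  mul_src_self : ∀ g, mul g (src g) = g
  tgt_mul_self : ∀ g, mul (tgt g) g = g
  mul_assoc : ∀ g h k, src g = tgt h → src h = tgt k → mul (mul g h) k = mul g (mul h k)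

/-- A partial category action of `G` on `X`, encoded as `act : M → X → Option X`
(`g·x` is defined iff `act g x = some y`, with value `y`).  The fields are the
axioms (C1) (split into two parts), (C2) and (C3); note that for `act h x = some y`,
the `Option`-equality `act (mul g h) x = act g y` says precisely that `(gh)·x` is
defined iff `g·(h·x)` is, and in that case the values agree. -/
structure IsPartialCatAction {M : Type u} {X : Type v} (C : PartialCat M)
    (act : M → X → Option X) : Prop where
  exists_obj_defined : ∀ x : X, ∃ e : M, C.obj e ∧ (act e x).isSome
  obj_act_eq : ∀ (f : M) (x y : X), C.obj f → act f x = some y → y = x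
  src_defined : ∀ (g : M) (x : X), (act g x).isSome → (act (C.src g) x).isSome
  comp_act : ∀ (g h : M) (x y : X), C.src g = C.tgt h → act h x = some y →
    act (C.mul g h) x = act g y

/-- Axiom (C4): the action is global. -/
def IsGlobal {M : Type u} {X : Type v} (C : PartialCat M) (act : M → X → Option X) : Prop :=
  ∀ (g : M) (x : X), (act (C.src g) x).isSome → (act g x).isSome

/-- `i : X → Y` is a `G`-function: whenever `g·x` is defined, `g·i(x)` is defined
and equals `i(g·x)`. -/
def IsGFun {M : Type u} {X : Type v} {Y : Type w}
    (actX : M → X → Option X) (actY : M → Y → Option Y) (i : X → Y) : Prop :=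
  ∀ (g : M) (x y : X), actX g x = some y → actY g (i x) = some (i y)

/-- `X_g = {x : g·x is defined}`. -/
def actSet {M : Type u} {X : Type v} (act : M → X → Option X) (g : M) : Set X :=
  {x | (act g x).isSome}

/-- `₍g₎X = {g·x : x ∈ X_g}`. -/
def actImg {M : Type u} {X : Type v} (act : M → X → Option X) (g : M) : Set X :=
  {y | ∃ x, act g x = some y}

/-- `X̄ = {(g,x) : d(g)·x is defined}`. -/
def Xbar {M : Type u} {X : Type v} (C : PartialCat M) (act : M → X → Option X) :
    Set (M × X) :=
  {p | (act (C.src p.1) p.2).isSome}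

/-- The relation `∼` on `X̄`: `(g,x) ∼ (g',x')` iff (i) there is `h` with
`(g',h)` composable, `h·x` defined, `g = g'h` and `x' = h·x`, or (ii) `x = x'`,
`g, g'` are objects and both `g·x`, `g'·x'` are defined. -/
def simRel {M : Type u} {X : Type v} (C : PartialCat M) (act : M → X → Option X)
    (p q : M × X) : Prop :=
  (∃ h : M, C.src q.1 = C.tgt h ∧ ∃ y : X, act h p.2 = some y ∧
    p.1 = C.mul q.1 h ∧ q.2 = y) ∨
  (p.2 = q.2 ∧ C.obj p.1 ∧ C.obj q.1 ∧ (act p.1 p.2).isSome ∧ (act q.1 q.2).isSome)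

/-- The relation `∼` regarded as a relation on `M × X` supported on `X̄`. -/
def simRelBar {M : Type u} {X : Type v} (C : PartialCat M) (act : M → X → Option X)
    (p q : M × X) : Prop :=
  p ∈ Xbar C act ∧ q ∈ Xbar C act ∧ simRel C act p q

/-- `≃`, the equivalence relation generated by `∼`. -/
def eqvRel {M : Type u} {X : Type v} (C : PartialCat M) (act : M → X → Option X) :
    M × X → M × X → Prop :=
  Relation.EqvGen (simRelBar C act)

/-- `X̄` as a type (with the subspace topology when relevant). -/
abbrev XbarT {M : Type u} {X : Type v} (C : PartialCat M) (act : M → X → Option X) :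
    Type (max u v) :=
  {p : M × X // p ∈ Xbar C act}

/-- `≃` as a relation on the type `X̄`. -/
def eqvT {M : Type u} {X : Type v} (C : PartialCat M) (act : M → X → Option X)
    (p q : XbarT C act) : Prop :=
  eqvRel C act p.1 q.1

/-- `Y = X̄ / ≃` (with the quotient topology when relevant). -/
abbrev Yglob {M : Type u} {X : Type v} (C : PartialCat M) (act : M → X → Option X) :
    Type (max u v) :=
  Quot (eqvT C act)

/-- `[g, x]`, the class of `(g,x) ∈ X̄` in `Y`. -/
def mkY {M : Type u} {X : Type v} (C : PartialCat M) (act : M → X → Option X)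
    (p : XbarT C act) : Yglob C act :=
  Quot.mk _ p

/-- Characterization of the induced action on `Y = X̄/≃`: `g·[h,x]` is defined iff
some `(h',x') ≃ (h,x)` has `(g,h')` composable, in which case `g·[h,x] = [gh',x']`. -/
def ActYSpec {M : Type u} {X : Type v} (C : PartialCat M) (act : M → X → Option X)
    (actY : M → Yglob C act → Option (Yglob C act)) : Prop :=
  ∀ (g : M) (p : XbarT C act),
    ((actY g (mkY C act p)).isSome ↔
      ∃ q : XbarT C act, eqvT C act p q ∧ C.src g = C.tgt q.1.1) ∧
    (∀ q : XbarT C act, eqvT C act p q → C.src g = C.tgt q.1.1 →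
      ∃ hm : (C.mul g q.1.1, q.1.2) ∈ Xbar C act,
        actY g (mkY C act p) = some (mkY C act ⟨(C.mul g q.1.1, q.1.2), hm⟩))

/-- Characterization of `i : X → Y`: `i x = [e, x]` for every object `e` with
`e·x` defined. -/
def ISpec {M : Type u} {X : Type v} (C : PartialCat M) (act : M → X → Option X)
    (i : X → Yglob C act) : Prop :=
  ∀ (x : X) (e : M), C.obj e → (act e x).isSome →
    ∃ hm : (e, x) ∈ Xbar C act, i x = mkY C act ⟨(e, x), hm⟩

/-- A small groupoid in morphisms-only style: a `PartialCat` in which every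
morphism `g` has an inverse `inv g`. -/
structure PartialGpd (M : Type u) extends PartialCat M where
  inv : M → M
  src_inv : ∀ g, src (inv g) = tgt g
  tgt_inv : ∀ g, tgt (inv g) = src g
  inv_mul_self : ∀ g, mul (inv g) g = src g
  mul_inv_self : ∀ g, mul g (inv g) = tgt g

/-- A partial groupoid action: axioms (GR1) (split into two parts), (GR2), (GR3). -/
structure IsPartialGpdAction {M : Type u} {X : Type v} (C : PartialGpd M)
    (act : M → X → Option X) : Prop where
  exists_obj_defined : ∀ x : X, ∃ e : M, C.obj e ∧ (act e x).isSome
  obj_act_eq : ∀ (f : M) (x y : X), C.obj f → act f x = some y → y = x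
  inv_act : ∀ (g : M) (x y : X), act g x = some y → act (C.inv g) y = some x
  comp_act : ∀ (g h : M) (x y z : X), C.src g = C.tgt h → act h x = some y →
    act g y = some z → act (C.mul g h) x = some z

/-- `G` is a topological category: composition `G² → mor(G)` is continuous,
where `G²` carries the subspace topology from `mor(G) × mor(G)`. -/
def ContComp {M : Type u} [TopologicalSpace M] (C : PartialCat M) : Prop :=
  Continuous (fun p : {q : M × M // C.src q.1 = C.tgt q.2} => C.mul p.1.1 p.1.2)

/-- Axioms (CA1) and (CA2): the sets `X_e` (`e` an object) are open, and the
action map `Γ → X` is continuous, where `Γ = {(g,x) : g·x defined}` carries the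
subspace topology from `mor(G) × X`. -/
def IsContAction {M : Type u} {X : Type v} [TopologicalSpace M] [TopologicalSpace X]
    (C : PartialCat M) (act : M → X → Option X) : Prop :=
  (∀ e : M, C.obj e → IsOpen {x : X | (act e x).isSome}) ∧
  Continuous (fun p : {q : M × X // (act q.1 q.2).isSome} => (act p.1.1 p.1.2).get p.2)

/-- `G` is star open: each `d⁻¹(e)` is open. -/
def IsStarOpen {M : Type u} [TopologicalSpace M] (C : PartialCat M) : Prop :=
  ∀ e : M, C.obj e → IsOpen {g : M | C.src g = e}

/-- The action is graph open: `Γ` is open in `mor(G) × X`. -/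
def IsGraphOpen {M : Type u} {X : Type v} [TopologicalSpace M] [TopologicalSpace X]
    (act : M → X → Option X) : Prop :=
  IsOpen {p : M × X | (act p.1 p.2).isSome}

/-- `Γ' = {(g,(h,x)) ∈ mor(G) × X̄ : d(g) = c(h)}`, with the subspace topology
from `mor(G) × mor(G) × X`. -/
abbrev GammaP {M : Type u} {X : Type v} (C : PartialCat M) (act : M → X → Option X) :
    Type (max u v) :=
  {q : M × XbarT C act // C.src q.1 = C.tgt q.2.1.1}

/-- The relation `≡` on `Γ'`: `(g,(h,x)) ≡ (g',(h',x'))` iff `g = g'` and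
`(h,x) ≃ (h',x')`. -/
def gammaEqv {M : Type u} {X : Type v} (C : PartialCat M) (act : M → X → Option X)
    (a b : GammaP C act) : Prop :=
  a.1.1 = b.1.1 ∧ eqvT C act a.1.2 b.1.2

/-- `Γ'' = Γ' / ≡`, with the quotient topology. -/
abbrev GammaQ {M : Type u} {X : Type v} (C : PartialCat M) (act : M → X → Option X) :
    Type (max u v) :=
  Quot (gammaEqv C act)

/-- Characterization of the map `Γ'' → Y` induced by `(g,(h,x)) ↦ [gh, x]`. -/
def BetaSpec {M : Type u} {X : Type v} (C : PartialCat M) (act : M → X → Option X)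
    (β : GammaQ C act → Yglob C act) : Prop :=
  ∀ a : GammaP C act, ∃ hm : (C.mul a.1.1 a.1.2.1.1, a.1.2.1.2) ∈ Xbar C act,
    β (Quot.mk _ a) = mkY C act ⟨(C.mul a.1.1 a.1.2.1.1, a.1.2.1.2), hm⟩

namespace PartialCat

variable {M : Type u}

lemma src_src (C : PartialCat M) (g : M) : C.src (C.src g) = C.src g :=
  C.src_obj _ (C.obj_src g)

lemma tgt_src (C : PartialCat M) (g : M) : C.tgt (C.src g) = C.src g :=
  C.tgt_obj _ (C.obj_src g)

lemma src_tgt (C : PartialCat M) (g : M) : C.src (C.tgt g) = C.tgt g :=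
  C.src_obj _ (C.obj_tgt g)

end PartialCat

section ObjAction

variable {M : Type u} {X : Type v} {C : PartialCat M} {act : M → X → Option X}

lemma IsPartialCatAction.act_obj (hact : IsPartialCatAction C act) {e : M} {x : X}
    (he : C.obj e) (h : (act e x).isSome) : act e x = some x := by
  obtain ⟨y, hy⟩ := Option.isSome_iff_exists.1 h
  rw [hy, hact.obj_act_eq e x y he hy]

lemma IsPartialCatAction.act_tgt (hact : IsPartialCatAction C act) {g : M} {x y : X}
    (h : act g x = some y) : act (C.tgt g) y = some y := by
  have h' := hact.comp_act (C.tgt g) g x y (C.src_tgt g) h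
  rw [C.tgt_mul_self, h] at h'
  exact h'.symm

end ObjAction

namespace Globalization

variable {M : Type u} {X : Type v} {C : PartialCat M} {act : M → X → Option X}

/-- The quotient of `X̄` by the equivalence relation generated by `∼`. -/
def Carrier (C : PartialCat M) (act : M → X → Option X) : Type (max u v) :=
  Quot fun p q : XbarT C act => simRel C act p.1 q.1

/-- The class `[g, x]`. -/
def mk (p : XbarT C act) : Carrier C act := Quot.mk _ p

lemma mem_Xbar {g : M} {x : X} : (g, x) ∈ Xbar C act ↔ (act (C.src g) x).isSome := Iff.rfl

/-- Left translation `(h, x) ↦ (g h, x)` on `X̄`. -/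
def translate (g : M) (p : XbarT C act) (h : C.src g = C.tgt p.1.1) : XbarT C act :=
  ⟨(C.mul g p.1.1, p.1.2), mem_Xbar.2 <| by
    rw [C.src_mul _ _ h]
    exact mem_Xbar.1 p.2⟩

lemma mk_eq_of_act (p q : XbarT C act) (h : M) (hc : C.src q.1.1 = C.tgt h)
    (hx : act h p.1.2 = some q.1.2) (hp : p.1.1 = C.mul q.1.1 h) : mk p = mk q :=
  Quot.sound (Or.inl ⟨h, hc, _, hx, hp, rfl⟩)

lemma mk_eq_of_obj (p q : XbarT C act) (hx : p.1.2 = q.1.2) (hp : C.obj p.1.1)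
    (hq : C.obj q.1.1) : mk p = mk q := by
  refine Quot.sound (Or.inr ⟨hx, hp, hq, ?_, ?_⟩)
  · have := mem_Xbar.1 p.2
    rwa [C.src_obj _ hp] at this
  · have := mem_Xbar.1 q.2
    rwa [C.src_obj _ hq] at this

/-- Equal classes either have the same defined value in `X`, or the same codomain and
equal left translates. -/
lemma act_eq_and_of_mk_eq (hact : IsPartialCatAction C act) {p q : XbarT C act}
    (h : mk p = mk q) :
    act p.1.1 p.1.2 = act q.1.1 q.1.2 ∧ ((act p.1.1 p.1.2).isSome ∨
      (C.tgt p.1.1 = C.tgt q.1.1 ∧ ∀ g hp hq, mk (translate g p hp) = mk (translate g q hq))) := by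
  have := Quot.eqvGen_exact h
  clear h
  induction this with
  | rel p q h =>
    rcases h with ⟨h, hc, y, hy, hp, rfl⟩ | ⟨hx, hp, hq, hp', hq'⟩
    · refine ⟨by rw [hp]; exact hact.comp_act _ _ _ _ hc hy, Or.inr ⟨?_, ?_⟩⟩
      · rw [hp, C.tgt_mul _ _ hc]
      · intro g h1 h2
        refine mk_eq_of_act _ _ h ?_ hy ?_
        · simp only [translate]
          rw [C.src_mul _ _ h2, hc]
        · simp only [translate]
          rw [hp, C.mul_assoc _ _ _ h2 hc]
    · refine ⟨?_, Or.inl hp'⟩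
      rw [hact.act_obj hp hp', hact.act_obj hq hq', hx]
  | refl p => exact ⟨rfl, Or.inr ⟨rfl, fun _ _ _ => rfl⟩⟩
  | symm p q _ ih =>
    obtain ⟨h1, h2 | ⟨h2, h3⟩⟩ := ih
    · exact ⟨h1.symm, Or.inl (h1 ▸ h2)⟩
    · exact ⟨h1.symm, Or.inr ⟨h2.symm, fun g hp hq => (h3 g hq hp).symm⟩⟩
  | trans p q r _ _ ih1 ih2 =>
    obtain ⟨h1, h2 | ⟨h2, h3⟩⟩ := ih1
    · exact ⟨h1.trans ih2.1, Or.inl h2⟩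
    · obtain ⟨h4, h5 | ⟨h5, h6⟩⟩ := ih2
      · exact ⟨h1.trans h4, Or.inl (h1 ▸ h5)⟩
      · exact ⟨h1.trans h4, Or.inr ⟨h2.trans h5, fun g hp hr =>
          (h3 g hp (hp.trans h2)).trans (h6 g (hp.trans h2) hr)⟩⟩

lemma mk_translate_eq_of_act (g : M) (p : XbarT C act)
    (hp : C.src g = C.tgt p.1.1) {z : X} (hz : act p.1.1 p.1.2 = some z)
    (hm : (g, z) ∈ Xbar C act) : mk (translate g p hp) = mk ⟨(g, z), hm⟩ :=
  mk_eq_of_act _ _ p.1.1 hp hz rfl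

lemma mk_translate_congr (hact : IsPartialCatAction C act) {g : M} {p q : XbarT C act}
    (h : mk p = mk q) (hp : C.src g = C.tgt p.1.1) (hq : C.src g = C.tgt q.1.1) :
    mk (translate g p hp) = mk (translate g q hq) := by
  obtain ⟨h1, h2 | ⟨-, h3⟩⟩ := act_eq_and_of_mk_eq hact h
  · obtain ⟨z, hz⟩ := Option.isSome_iff_exists.1 h2
    have hm : (g, z) ∈ Xbar C act := by
      rw [mem_Xbar, hp, hact.act_tgt hz]
      rfl
    rw [mk_translate_eq_of_act g p hp hz hm,
      mk_translate_eq_of_act g q hq (h1 ▸ hz) hm]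
  · exact h3 g hp hq

open Classical in
/-- The action on the quotient: `g · [h, x] = [g h, x]` whenever the class has a
representative `(h, x)` with `(g, h)` composable. -/
noncomputable def action (C : PartialCat M) (act : M → X → Option X) (g : M)
    (y : Carrier C act) : Option (Carrier C act) :=
  if h : ∃ q : XbarT C act, mk q = y ∧ C.src g = C.tgt q.1.1 then
    some (mk (translate g h.choose h.choose_spec.2))
  else none

lemma action_mk (hact : IsPartialCatAction C act) (g : M) (p : XbarT C act)
    (hp : C.src g = C.tgt p.1.1) : action C act g (mk p) = some (mk (translate g p hp)) := by
  have h : ∃ q : XbarT C act, mk q = mk p ∧ C.src g = C.tgt q.1.1 := ⟨p, rfl, hp⟩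
  rw [action, dif_pos h]
  exact congrArg some (mk_translate_congr hact h.choose_spec.1 _ _)

lemma exists_rep_of_isSome {g : M} {y : Carrier C act} (h : (action C act g y).isSome) :
    ∃ q : XbarT C act, mk q = y ∧ C.src g = C.tgt q.1.1 := by
  by_contra hn
  rw [action, dif_neg hn] at h
  exact absurd h (by simp)

lemma translate_obj {f : M} (hf : C.obj f) (p : XbarT C act) (hp : C.src f = C.tgt p.1.1) :
    translate f p hp = p := by
  refine Subtype.ext (Prod.ext ?_ rfl)
  rw [C.src_obj f hf] at hp
  subst hp
  exact C.tgt_mul_self _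

lemma isPartialCatAction_action (hact : IsPartialCatAction C act) :
    IsPartialCatAction C (action C act) where
  exists_obj_defined y := by
    obtain ⟨p, rfl⟩ := Quot.exists_rep y
    refine ⟨C.tgt p.1.1, C.obj_tgt _, ?_⟩
    have := action_mk hact (C.tgt p.1.1) p (C.src_tgt _)
    exact Option.isSome_iff_exists.2 ⟨_, this⟩
  obj_act_eq f x y hf h := by
    obtain ⟨p, rfl, hp⟩ := exists_rep_of_isSome (Option.isSome_iff_exists.2 ⟨y, h⟩)
    rw [action_mk hact f p hp, translate_obj hf] at h
    exact (Option.some.inj h).symm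
  src_defined g x h := by
    obtain ⟨p, rfl, hp⟩ := exists_rep_of_isSome h
    rw [action_mk hact _ p ((C.src_src g).trans hp)]
    rfl
  comp_act g h x y hgh hy := by
    obtain ⟨p, rfl, hp⟩ := exists_rep_of_isSome (Option.isSome_iff_exists.2 ⟨y, hy⟩)
    rw [action_mk hact h p hp] at hy
    obtain rfl := Option.some.inj hy
    rw [action_mk hact _ p ((C.src_mul g h hgh).trans hp),
      action_mk hact g (translate h p hp) (hgh.trans (C.tgt_mul _ _ hp).symm)]
    congr 2
    exact Subtype.ext (Prod.ext (C.mul_assoc _ _ _ hgh hp) rfl)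

lemma isGlobal_action (hact : IsPartialCatAction C act) : IsGlobal C (action C act) := by
  intro g y h
  obtain ⟨p, rfl, hp⟩ := exists_rep_of_isSome h
  rw [action_mk hact g p ((C.src_src g).symm.trans hp)]
  rfl

lemma obj_mem_Xbar {e : M} {x : X} (he : C.obj e) (h : (act e x).isSome) :
    (e, x) ∈ Xbar C act := by
  rwa [mem_Xbar, C.src_obj e he]

/-- The canonical map `x ↦ [e, x]`, for any object `e` with `e · x` defined. -/
noncomputable def incl (hact : IsPartialCatAction C act) (x : X) : Carrier C act :=
  mk ⟨((hact.exists_obj_defined x).choose, x),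
    obj_mem_Xbar (hact.exists_obj_defined x).choose_spec.1
      (hact.exists_obj_defined x).choose_spec.2⟩

lemma incl_eq (hact : IsPartialCatAction C act) {e : M} {x : X} (he : C.obj e)
    (hm : (e, x) ∈ Xbar C act) : incl hact x = mk ⟨(e, x), hm⟩ :=
  mk_eq_of_obj _ _ rfl (hact.exists_obj_defined x).choose_spec.1 he

lemma action_incl (hact : IsPartialCatAction C act) (p : XbarT C act) :
    action C act p.1.1 (incl hact p.1.2) = some (mk p) := by
  rw [incl_eq hact (C.obj_src p.1.1) (obj_mem_Xbar (C.obj_src _) p.2),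
    action_mk hact _ _ (C.tgt_src _).symm]
  congr 2
  exact Subtype.ext (Prod.ext (C.mul_src_self _) rfl)

lemma isGFun_incl (hact : IsPartialCatAction C act) :
    IsGFun act (action C act) (incl hact) := by
  intro g x y h
  have hm : (g, x) ∈ Xbar C act := hact.src_defined g x (by rw [h]; rfl)
  have ht : (C.tgt g, y) ∈ Xbar C act :=
    obj_mem_Xbar (C.obj_tgt g) (by rw [hact.act_tgt h]; rfl)
  rw [action_incl hact ⟨(g, x), hm⟩, incl_eq hact (C.obj_tgt g) ht]
  exact congrArg some (mk_eq_of_act _ _ g (C.src_tgt g) h (C.tgt_mul_self g).symm)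

section Lift

variable {Z : Type w} {actZ : M → Z → Option Z} {j : X → Z}

lemma isSome_act_of_mem_Xbar (hact : IsPartialCatAction C act) (hglob : IsGlobal C actZ)
    (hj : IsGFun act actZ j) (p : XbarT C act) : (actZ p.1.1 (j p.1.2)).isSome := by
  apply hglob
  rw [hj _ _ _ (hact.act_obj (C.obj_src _) p.2)]
  rfl

/-- The map `[g, x] ↦ g · j x` induced by a `G`-function `j` into a global action. -/
def lift (hact : IsPartialCatAction C act) (hZ : IsPartialCatAction C actZ)
    (hglob : IsGlobal C actZ) (hj : IsGFun act actZ j) : Carrier C act → Z :=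
  Quot.lift (fun p => (actZ p.1.1 (j p.1.2)).get (isSome_act_of_mem_Xbar hact hglob hj p)) <| by
    rintro p q (⟨h, hc, y, hy, hp, rfl⟩ | ⟨hx, hp, hq, hp', hq'⟩)
    · apply Option.some.inj
      rw [Option.some_get, Option.some_get, hp]
      exact hZ.comp_act _ _ _ _ hc (hj _ _ _ hy)
    · apply Option.some.inj
      rw [Option.some_get, Option.some_get, hj _ _ _ (hact.act_obj hp hp'),
        hj _ _ _ (hact.act_obj hq hq'), hx]

lemma act_eq_some_lift (hact : IsPartialCatAction C act) (hZ : IsPartialCatAction C actZ)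
    (hglob : IsGlobal C actZ) (hj : IsGFun act actZ j) (p : XbarT C act) :
    actZ p.1.1 (j p.1.2) = some (lift hact hZ hglob hj (mk p)) :=
  (Option.some_get (isSome_act_of_mem_Xbar hact hglob hj p)).symm

lemma isGFun_lift (hact : IsPartialCatAction C act) (hZ : IsPartialCatAction C actZ)
    (hglob : IsGlobal C actZ) (hj : IsGFun act actZ j) :
    IsGFun (action C act) actZ (lift hact hZ hglob hj) := by
  intro g x y h
  obtain ⟨p, rfl, hp⟩ := exists_rep_of_isSome (Option.isSome_iff_exists.2 ⟨y, h⟩)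
  rw [action_mk hact g p hp] at h
  obtain rfl := Option.some.inj h
  rw [← act_eq_some_lift]
  exact (hZ.comp_act g p.1.1 _ _ hp (act_eq_some_lift hact hZ hglob hj p)).symm

lemma lift_incl (hact : IsPartialCatAction C act) (hZ : IsPartialCatAction C actZ)
    (hglob : IsGlobal C actZ) (hj : IsGFun act actZ j) (x : X) :
    lift hact hZ hglob hj (incl hact x) = j x := by
  obtain ⟨e, he, hx⟩ := hact.exists_obj_defined x
  apply Option.some.inj
  rw [incl_eq hact he (obj_mem_Xbar he hx), ← act_eq_some_lift]
  exact hj _ _ _ (hact.act_obj he hx)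

lemma eq_lift (hact : IsPartialCatAction C act) (hZ : IsPartialCatAction C actZ)
    (hglob : IsGlobal C actZ) (hj : IsGFun act actZ j) {k : Carrier C act → Z}
    (hk : IsGFun (action C act) actZ k) (hkj : j = k ∘ incl hact) :
    k = lift hact hZ hglob hj := by
  funext y
  obtain ⟨p, rfl⟩ := Quot.exists_rep y
  have h := hk _ _ _ (action_incl hact p)
  rw [← Function.comp_apply (f := k), ← hkj, act_eq_some_lift hact hZ hglob hj] at h
  exact (Option.some.inj h).symm

end Lift

end Globalization

/-- Every partial category action on a set admits a universal
globalization. -/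
theorem stmt0 {M X : Type u} (C : PartialCat M) (act : M → X → Option X)
    (hact : IsPartialCatAction C act) :
    ∃ (Y : Type u) (actY : M → Y → Option Y) (i : X → Y),
      IsPartialCatAction C actY ∧ IsGlobal C actY ∧ IsGFun act actY i ∧
      ∀ (Z : Type u) (actZ : M → Z → Option Z) (j : X → Z),
        IsPartialCatAction C actZ → IsGlobal C actZ → IsGFun act actZ j →
        ∃! k : Y → Z, IsGFun actY actZ k ∧ j = k ∘ i := by
  refine ⟨Globalization.Carrier C act, Globalization.action C act, Globalization.incl hact,
    Globalization.isPartialCatAction_action hact, Globalization.isGlobal_action hact,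
    Globalization.isGFun_incl hact, fun Z actZ j hZ hglob hj => ?_⟩
  exact ⟨Globalization.lift hact hZ hglob hj,
    ⟨Globalization.isGFun_lift hact hZ hglob hj,
      funext fun x => (Globalization.lift_incl hact hZ hglob hj x).symm⟩,
    fun k hk => Globalization.eq_lift hact hZ hglob hj hk.1 hk.2⟩
end

section
/- Let a small category G act partially on a set X. If (g,x), (g',x') ∈ X̄ satisfy (g,x) ∼ (g',x'), then for every p ∈ mor(G) with (p,g) ∈ G² and (p,g') ∈ G², one has (pg,x) ∼ (pg',x'). -/
universe u v w

/-- If `(g,x) ∼ (g',x')` in `X̄` and `p` is composable with both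
`g` and `g'`, then `(pg,x) ∼ (pg',x')`. -/
theorem stmt7 {M X : Type u} (C : PartialCat M) (act : M → X → Option X)
    (hact : IsPartialCatAction C act)
    (p q : M × X) (hp : p ∈ Xbar C act) (hq : q ∈ Xbar C act)
    (hpq : simRel C act p q)
    (r : M) (hr : C.src r = C.tgt p.1) (hr' : C.src r = C.tgt q.1) :
    simRel C act (C.mul r p.1, p.2) (C.mul r q.1, q.2) := by
  obtain ⟨g, x⟩ := p
  obtain ⟨g', x'⟩ := q
  dsimp only at hr hr' ⊢
  rcases hpq with ⟨h, hcomp, y, hact_h, rfl, rfl⟩ | ⟨rfl, hg, hg', hdef, -⟩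
  · exact Or.inl ⟨h, (C.src_mul r g' hr').trans hcomp, _, hact_h,
      (C.mul_assoc r g' h hr' hcomp).symm, rfl⟩
  · dsimp only at hg hg' hdef
    rw [C.tgt_obj g hg] at hr
    rw [C.tgt_obj g' hg'] at hr'
    subst hr hr'
    obtain ⟨y, hy⟩ := Option.isSome_iff_exists.mp hdef
    refine Or.inl ⟨C.src r, ?_, y, hy, ?_, (hact.obj_act_eq _ _ _ hg hy).symm⟩ <;>
      simp only [C.mul_src_self, C.tgt_obj _ hg]
end

section
/- Let a small category G act partially on a set X and let ≃ be the equivalence relation on X̄ generated by ∼. If (g,x), (g',x') ∈ X̄ satisfy (g,x) ≃ (g',x'), then g·x is defined if and only if g'·x' is defined, and in that case g·x = g'·x'. -/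
universe u v w

theorem IsPartialCatAction.act_eq_of_simRel {M : Type u} {X : Type v} {C : PartialCat M}
    {act : M → X → Option X} (hact : IsPartialCatAction C act) {p q : M × X}
    (h : simRel C act p q) : act p.1 p.2 = act q.1 q.2 := by
  obtain ⟨h, hc, y, hy, hp, hq⟩ | ⟨hx, hp, hq, hpx, hqx⟩ := h
  · rw [hp, hq]
    exact hact.comp_act _ _ _ _ hc hy
  · obtain ⟨a, ha⟩ := Option.isSome_iff_exists.mp hpx
    obtain ⟨b, hb⟩ := Option.isSome_iff_exists.mp hqx
    rw [ha, hb, hact.obj_act_eq _ _ _ hp ha, hact.obj_act_eq _ _ _ hq hb, hx]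

theorem IsPartialCatAction.act_eq_of_eqvRel {M : Type u} {X : Type v} {C : PartialCat M}
    {act : M → X → Option X} (hact : IsPartialCatAction C act) {p q : M × X}
    (h : eqvRel C act p q) : act p.1 p.2 = act q.1 q.2 := by
  induction h with
  | rel _ _ h => exact hact.act_eq_of_simRel h.2.2
  | refl _ => rfl
  | symm _ _ _ ih => exact ih.symm
  | trans _ _ _ _ _ ih₁ ih₂ => exact ih₁.trans ih₂

/-- If `(g,x) ≃ (g',x')` in `X̄` (where `≃` is the equivalence
relation generated by `∼`), then `g·x` is defined iff `g'·x'` is defined, and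
in that case `g·x = g'·x'`. -/
theorem stmt8 {M X : Type u} (C : PartialCat M) (act : M → X → Option X)
    (hact : IsPartialCatAction C act)
    (p q : M × X) (hp : p ∈ Xbar C act) (hq : q ∈ Xbar C act)
    (hpq : eqvRel C act p q) :
    ((act p.1 p.2).isSome ↔ (act q.1 q.2).isSome) ∧
    (∀ y, act p.1 p.2 = some y → act q.1 q.2 = some y) := by
  have h := hact.act_eq_of_eqvRel hpq
  exact ⟨by rw [h], fun y hy => h ▸ hy⟩
end

section
/- Let a small category G act partially on a set X and let Y = X̄/≃ with classes [g,x]. The partial set action of mor(G) on Y given by: g·[h,x] is defined if and only if there exists (h',x') ∈ X̄ with (h,x) ≃ (h',x') and (g,h') ∈ G², in which case g·[h,x] = [gh',x'], is well defined (the value [gh',x'] does not depend on the choice of representative (h',x')), and it is a global category action of G on Y, i.e. it satisfies (C1), (C2), (C3) and (C4). -/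
universe u v w

section Globalization

variable {M : Type u} {X : Type v} {C : PartialCat M} {act : M → X → Option X}

theorem eqvT_equivalence : Equivalence (eqvT C act) where
  refl p := Relation.EqvGen.refl p.1
  symm h := Relation.EqvGen.symm _ _ h
  trans h k := Relation.EqvGen.trans _ _ _ h k

theorem mkY_eq_iff {p q : XbarT C act} : mkY C act p = mkY C act q ↔ eqvT C act p q :=
  ⟨fun h => eqvT_equivalence.eqvGen_iff.1 (Quot.eqvGen_exact h), fun h => Quot.sound h⟩

theorem mul_mem_Xbar {g : M} {p : M × X} (hp : p ∈ Xbar C act) (hg : C.src g = C.tgt p.1) :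
    (C.mul g p.1, p.2) ∈ Xbar C act := by
  simpa [Xbar, C.src_mul g p.1 hg] using hp

/-- Left multiplication by `g` sends `(h, x)` to an element related to `(g, h·x)`
when `h·x` is defined. -/
theorem simRelBar_mul_of_act (hact : IsPartialCatAction C act) {g : M} {p : M × X} {y : X}
    (hp : p ∈ Xbar C act) (hg : C.src g = C.tgt p.1) (hy : act p.1 p.2 = some y) :
    simRelBar C act (C.mul g p.1, p.2) (g, y) := by
  refine ⟨mul_mem_Xbar hp hg, ?_, Or.inl ⟨p.1, hg, y, hy, rfl, rfl⟩⟩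
  have h := hact.comp_act (C.tgt p.1) p.1 p.2 y (C.src_obj _ (C.obj_tgt _)) hy
  rw [C.tgt_mul_self, hy] at h
  simp [Xbar, hg, ← h]

/-- The partial value `g·x` is an invariant of the class of `(g, x)`; where it is undefined,
the codomain of `g` is an invariant too, and left multiplication respects `≃`. -/
theorem eqvRel.act_eq (hact : IsPartialCatAction C act) {p q : M × X}
    (h : eqvRel C act p q) :
    act p.1 p.2 = act q.1 q.2 ∧
      (act p.1 p.2 = none → C.tgt p.1 = C.tgt q.1 ∧ ∀ g, C.src g = C.tgt p.1 →
        eqvRel C act (C.mul g p.1, p.2) (C.mul g q.1, q.2)) := by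
  induction h with
  | refl p => exact ⟨rfl, fun _ => ⟨rfl, fun _ _ => .refl _⟩⟩
  | symm p q _ ih =>
    refine ⟨ih.1.symm, fun hq => ?_⟩
    obtain ⟨ht, hm⟩ := ih.2 (ih.1.trans hq)
    exact ⟨ht.symm, fun g hg => .symm _ _ (hm g (hg.trans ht.symm))⟩
  | trans p q r _ _ ih₁ ih₂ =>
    refine ⟨ih₁.1.trans ih₂.1, fun hp => ?_⟩
    obtain ⟨ht₁, hm₁⟩ := ih₁.2 hp
    obtain ⟨ht₂, hm₂⟩ := ih₂.2 (ih₁.1.symm.trans hp)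
    exact ⟨ht₁.trans ht₂, fun g hg => .trans _ _ _ (hm₁ g hg) (hm₂ g (hg.trans ht₁))⟩
  | rel p q h =>
    obtain ⟨hp, hq, ⟨k, hk, y, hy, hpk, hqy⟩ | ⟨hx, hp₁, hq₁, hp₂, hq₂⟩⟩ := h
    · refine ⟨by rw [hpk, hqy, hact.comp_act _ _ _ _ hk hy], fun _ => ?_⟩
      have ht : C.tgt p.1 = C.tgt q.1 := by rw [hpk, C.tgt_mul _ _ hk]
      refine ⟨ht, fun g hg => .rel _ _ ⟨mul_mem_Xbar hp hg, mul_mem_Xbar hq (hg.trans ht),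
        Or.inl ⟨k, ?_, y, hy, ?_, hqy⟩⟩⟩
      · rw [← hk, C.src_mul _ _ (hg.trans ht)]
      · simp only [hpk]
        rw [C.mul_assoc _ _ _ (hg.trans ht) hk]
    · obtain ⟨a, ha⟩ := Option.isSome_iff_exists.1 hp₂
      obtain ⟨b, hb⟩ := Option.isSome_iff_exists.1 hq₂
      have ha' := hact.obj_act_eq _ _ _ hp₁ ha
      have hb' := hact.obj_act_eq _ _ _ hq₁ hb
      exact ⟨by rw [ha, hb, ha', hb', hx], fun hn => by simp [hn] at hp₂⟩

theorem eqvRel.mul_left (hact : IsPartialCatAction C act) {p q : M × X} {g : M}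
    (h : eqvRel C act p q) (hp : p ∈ Xbar C act) (hq : q ∈ Xbar C act)
    (hgp : C.src g = C.tgt p.1) (hgq : C.src g = C.tgt q.1) :
    eqvRel C act (C.mul g p.1, p.2) (C.mul g q.1, q.2) := by
  obtain ⟨he, hn⟩ := h.act_eq hact
  cases hy : act p.1 p.2 with
  | none => exact (hn hy).2 g hgp
  | some y =>
    exact .trans _ _ _ (.rel _ _ (simRelBar_mul_of_act hact hp hgp hy))
      (.symm _ _ (.rel _ _ (simRelBar_mul_of_act hact hq hgq (he.symm.trans hy))))

open Classical in
/-- The action of `mor(G)` on `Y`, defined through a chosen composable representative. -/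
noncomputable def inducedAct (C : PartialCat M) (act : M → X → Option X) (g : M)
    (y : Yglob C act) : Option (Yglob C act) :=
  if h : ∃ q : XbarT C act, mkY C act q = y ∧ C.src g = C.tgt q.1.1 then
    some (mkY C act ⟨(C.mul g h.choose.1.1, h.choose.1.2),
      mul_mem_Xbar h.choose.2 h.choose_spec.2⟩)
  else none

theorem inducedAct_isSome_iff {g : M} {y : Yglob C act} :
    (inducedAct C act g y).isSome ↔
      ∃ q : XbarT C act, mkY C act q = y ∧ C.src g = C.tgt q.1.1 := by
  unfold inducedAct
  split_ifs with h <;> simp [h]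

theorem inducedAct_mkY (hact : IsPartialCatAction C act) {g : M} (q : XbarT C act)
    (hg : C.src g = C.tgt q.1.1) :
    inducedAct C act g (mkY C act q) =
      some (mkY C act ⟨(C.mul g q.1.1, q.1.2), mul_mem_Xbar q.2 hg⟩) := by
  have h : ∃ r : XbarT C act, mkY C act r = mkY C act q ∧ C.src g = C.tgt r.1.1 := ⟨q, rfl, hg⟩
  rw [inducedAct, dif_pos h, Option.some_inj, mkY_eq_iff]
  exact eqvRel.mul_left hact (mkY_eq_iff.1 h.choose_spec.1) h.choose.2 q.2 h.choose_spec.2 hg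

theorem inducedAct_spec (hact : IsPartialCatAction C act) :
    ActYSpec C act (inducedAct C act) := by
  refine fun g p => ⟨?_, fun q hpq hg => ⟨mul_mem_Xbar q.2 hg, ?_⟩⟩
  · simp only [inducedAct_isSome_iff, eq_comm (b := mkY C act p), mkY_eq_iff]
  · rw [mkY_eq_iff.2 hpq, inducedAct_mkY hact q hg]

theorem inducedAct_isGlobal : IsGlobal C (inducedAct C act) := by
  intro g y
  simp only [inducedAct_isSome_iff, C.src_obj _ (C.obj_src g), imp_self]

theorem inducedAct_isPartialCatAction (hact : IsPartialCatAction C act) :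
    IsPartialCatAction C (inducedAct C act) where
  exists_obj_defined y := by
    obtain ⟨p, rfl⟩ := Quot.exists_rep y
    exact ⟨C.tgt p.1.1, C.obj_tgt _,
      inducedAct_isSome_iff.2 ⟨p, rfl, C.src_obj _ (C.obj_tgt _)⟩⟩
  obj_act_eq f y z hf h := by
    obtain ⟨q, rfl, hq⟩ := inducedAct_isSome_iff.1 (Option.isSome_of_eq_some h)
    rw [inducedAct_mkY hact q hq, Option.some_inj] at h
    rw [← h]
    congr 1
    ext1
    rw [C.src_obj f hf] at hq
    simp only [hq, C.tgt_mul_self]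
  src_defined g y := by
    simp only [inducedAct_isSome_iff, C.src_obj _ (C.obj_src g), imp_self]
  comp_act g h y z hgh hz := by
    obtain ⟨q, rfl, hq⟩ := inducedAct_isSome_iff.1 (Option.isSome_of_eq_some hz)
    rw [inducedAct_mkY hact q hq, Option.some_inj] at hz
    rw [← hz, inducedAct_mkY hact q ((C.src_mul g h hgh).trans hq),
      inducedAct_mkY hact _ (hgh.trans (C.tgt_mul h q.1.1 hq).symm)]
    simp only [C.mul_assoc g h q.1.1 hgh hq]

end Globalization

/-- The partial set action of `mor(G)` on `Y = X̄/≃` given by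
`g·[h,x] = [gh',x']` (defined iff some `(h',x') ≃ (h,x)` has `(g,h')` composable)
is well defined, and it is a global category action of `G` on `Y`.  The existence
of a function `actY` satisfying `ActYSpec` expresses well-definedness. -/
theorem stmt9 {M X : Type u} (C : PartialCat M) (act : M → X → Option X)
    (hact : IsPartialCatAction C act) :
    ∃ actY : M → Yglob C act → Option (Yglob C act),
      ActYSpec C act actY ∧ IsPartialCatAction C actY ∧ IsGlobal C actY := by
  exact ⟨inducedAct C act, inducedAct_spec hact, inducedAct_isPartialCatAction hact,
    inducedAct_isGlobal⟩
end

section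
/- Let G be a small groupoid with a partial groupoid action on a set X. Then the pair ({X_g}, {α_g}) satisfies: (GR1') X = ⋃_{e ∈ ob(G)} X_e and α_e = id_{X_e} for every e ∈ ob(G); (GR2') X_g ⊆ X_{d(g)} for every g ∈ mor(G); (GR3') for every (g,h) ∈ G², α_h(X_h ∩ X_{gh}) = X_g ∩ X_{h⁻¹}, and α_g(α_h(x)) = α_{gh}(x) for every x ∈ X_h ∩ X_{gh}. -/
universe u v w

namespace PartialGpd

variable {M : Type u} (C : PartialGpd M)

theorem inv_inv (h : M) : C.inv (C.inv h) = h := by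
  have h1 := C.mul_assoc h (C.inv h) (C.inv (C.inv h)) (C.tgt_inv h).symm
    (C.tgt_inv (C.inv h)).symm
  have h2 : C.tgt (C.inv (C.inv h)) = C.tgt h := by rw [C.tgt_inv, C.src_inv]
  rw [C.mul_inv_self, C.mul_inv_self, C.tgt_inv, C.mul_src_self, ← h2,
    C.tgt_mul_self] at h1
  exact h1

theorem mul_mul_inv_cancel {g h : M} (hgh : C.src g = C.tgt h) :
    C.mul (C.mul g h) (C.inv h) = g := by
  rw [C.mul_assoc g h (C.inv h) hgh (C.tgt_inv h).symm, C.mul_inv_self, ← hgh,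
    C.mul_src_self]

end PartialGpd

namespace IsPartialGpdAction

variable {M : Type u} {X : Type v} {C : PartialGpd M} {act : M → X → Option X}

theorem act_src (hact : IsPartialGpdAction C act) {g : M} {x y : X}
    (h : act g x = some y) : act (C.src g) x = some x := by
  rw [← C.inv_mul_self]
  exact hact.comp_act _ _ _ _ _ (C.src_inv g) h (hact.inv_act _ _ _ h)

theorem act_of_act_inv (hact : IsPartialGpdAction C act) {g : M} {x y : X}
    (h : act (C.inv g) y = some x) : act g x = some y := by
  simpa only [C.inv_inv] using hact.inv_act _ _ _ h

theorem act_of_act_mul (hact : IsPartialGpdAction C act) {g h : M} {x y z : X}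
    (hgh : C.src g = C.tgt h) (hy : act h x = some y) (hz : act (C.mul g h) x = some z) :
    act g y = some z := by
  have key := hact.comp_act (C.mul g h) (C.inv h) y x z
    (by rw [C.src_mul g h hgh, C.tgt_inv]) (hact.inv_act _ _ _ hy) hz
  rwa [C.mul_mul_inv_cancel hgh] at key

end IsPartialGpdAction

/-- The pair `({X_g}, {α_g})` of a partial groupoid action
satisfies (GR1'), (GR2') and (GR3'). -/
theorem stmt14 {M X : Type u} (C : PartialGpd M) (act : M → X → Option X)
    (hact : IsPartialGpdAction C act) :
    -- (GR1')
    ((Set.univ : Set X) = ⋃ e ∈ {e : M | C.obj e}, actSet act e) ∧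
    (∀ e : M, C.obj e → ∀ x ∈ actSet act e, act e x = some x) ∧
    -- (GR2')
    (∀ g : M, actSet act g ⊆ actSet act (C.src g)) ∧
    -- (GR3')
    (∀ g h : M, C.src g = C.tgt h →
      ({y | ∃ x ∈ actSet act h ∩ actSet act (C.mul g h), act h x = some y} =
        actSet act g ∩ actSet act (C.inv h)) ∧
      (∀ x ∈ actSet act h ∩ actSet act (C.mul g h),
        (act h x).bind (act g) = act (C.mul g h) x)) := by
  simp only [actSet, Set.subset_def, Set.mem_inter_iff, Set.mem_ofPred_eq,
    Option.isSome_iff_exists]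
  refine ⟨?_, ?_, ?_, fun g h hgh => ⟨?_, ?_⟩⟩
  · ext x
    simpa [Option.isSome_iff_exists] using hact.exists_obj_defined x
  · rintro e he x ⟨y, hy⟩
    rw [hy, hact.obj_act_eq e x y he hy]
  · rintro g x ⟨y, hy⟩
    exact ⟨x, hact.act_src hy⟩
  · ext y
    constructor
    · rintro ⟨x, ⟨-, z, hz⟩, hy⟩
      exact ⟨⟨z, hact.act_of_act_mul hgh hy hz⟩, x, hact.inv_act _ _ _ hy⟩
    · rintro ⟨⟨z, hz⟩, x, hx⟩
      have hy := hact.act_of_act_inv hx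
      exact ⟨x, ⟨⟨y, hy⟩, z, hact.comp_act _ _ _ _ _ hgh hy hz⟩, hy⟩
  · rintro x ⟨⟨y, hy⟩, z, hz⟩
    rw [hy, hz, Option.bind_some, hact.act_of_act_mul hgh hy hz]
end

section
/- Let G be a topological category acting continuously and partially on a topological space X. Give X̄ = {(g,x) ∈ mor(G) × X : d(g)·x is defined} the subspace topology from mor(G) × X and give Y = X̄/≃ the quotient topology. Then the induced global category action of G on Y is continuous (the map Γ'' → Y induced by (g,(h,x)) ↦ [gh,x] is continuous), and the map i : X → Y, i(x) = [e,x] for any e ∈ ob(G) with e·x defined, is continuous. -/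
universe u v w

/-- For a continuous partial category action of a topological
category, the induced global action on `Y = X̄/≃` (with the quotient topology)
is continuous, in the sense that the map `Γ'' → Y` induced by
`(g,(h,x)) ↦ [gh,x]` is continuous, and the map `i : X → Y`, `i(x) = [e,x]`,
is continuous. -/
theorem stmt16 {M X : Type u} [TopologicalSpace M] [TopologicalSpace X]
    (C : PartialCat M) (hcomp : ContComp C)
    (act : M → X → Option X) (hact : IsPartialCatAction C act)
    (hcont : IsContAction C act) :
    (∀ β : GammaQ C act → Yglob C act, BetaSpec C act β → Continuous β) ∧
    (∀ i : X → Yglob C act, ISpec C act i → Continuous i) := by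
  constructor
  · intro β hβ
    choose hm hβ using hβ
    rw [isQuotientMap_quot_mk.continuous_iff]
    have hpair : Continuous (fun a : GammaP C act =>
        (⟨(a.1.1, a.1.2.1.1), a.2⟩ : {q : M × M // C.src q.1 = C.tgt q.2})) := by
      fun_prop
    have hmul : Continuous (fun a : GammaP C act => C.mul a.1.1 a.1.2.1.1) :=
      Continuous.comp hcomp hpair
    have hbar : Continuous (fun a : GammaP C act =>
        (⟨(C.mul a.1.1 a.1.2.1.1, a.1.2.1.2), hm a⟩ : XbarT C act)) :=
      Continuous.subtype_mk (hmul.prodMk (by fun_prop)) _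
    exact (continuous_quot_mk.comp hbar).congr fun a => (hβ a).symm
  · intro i hi
    rw [continuous_iff_continuousAt]
    intro x
    obtain ⟨e, he, hex⟩ := hact.exists_obj_defined x
    have hopen : IsOpen {x : X | (act e x).isSome} := hcont.1 e he
    refine ContinuousOn.continuousAt ?_ (hopen.mem_nhds hex)
    rw [continuousOn_iff_continuous_domRestrict]
    have hmem : ∀ z : {x : X | (act e x).isSome}, (e, z.1) ∈ Xbar C act :=
      fun z => (hi z.1 e he z.2).choose
    have hbar : Continuous (fun z : {x : X | (act e x).isSome} =>
        (⟨(e, z.1), hmem z⟩ : XbarT C act)) := by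
      fun_prop
    exact (continuous_quot_mk.comp hbar).congr fun z =>
      (hi z.1 e he z.2).choose_spec.symm
end

section
/- Let G be a topological category that is star open, and let X be a topological space with a continuous partial category action of G that is graph open. Give X̄ the subspace topology from mor(G) × X and Y = X̄/≃ the quotient topology. Then the map i : X → Y, i(x) = [e,x] for any e ∈ ob(G) with e·x defined, is an open map. -/
universe u v w

/-- Classes in `Y` with a common value have equal action values. -/
theorem IsPartialCatAction.act_eq_of_mkY_eq {M : Type u} {X : Type v} {C : PartialCat M}
    {act : M → X → Option X} (hact : IsPartialCatAction C act) {p q : XbarT C act}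
    (h : mkY C act p = mkY C act q) : act p.1.1 p.1.2 = act q.1.1 q.1.2 :=
  congrArg (Quot.lift (fun p : XbarT C act => act p.1.1 p.1.2)
    fun _ _ h => hact.act_eq_of_eqvRel h) h

/-- If `g·x = y` then `c(g)·y = y`. -/
theorem IsPartialCatAction.tgt_act {M : Type u} {X : Type v} {C : PartialCat M}
    {act : M → X → Option X} (hact : IsPartialCatAction C act) {g : M} {x y : X}
    (h : act g x = some y) : act (C.tgt g) y = some y := by
  rw [← hact.comp_act _ _ _ _ (C.src_obj _ (C.obj_tgt g)) h, C.tgt_mul_self, h]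

/-- `[g, x] = i y` if and only if `g·x` is defined and equal to `y`. -/
theorem IsPartialCatAction.mkY_eq_iff {M : Type u} {X : Type v} {C : PartialCat M}
    {act : M → X → Option X} (hact : IsPartialCatAction C act) {i : X → Yglob C act}
    (hi : ISpec C act i) (p : XbarT C act) (y : X) :
    i y = mkY C act p ↔ act p.1.1 p.1.2 = some y := by
  constructor
  · intro h
    obtain ⟨e, he, hd⟩ := hact.exists_obj_defined y
    obtain ⟨_, hiy⟩ := hi y e he hd
    obtain ⟨z, hz⟩ := Option.isSome_iff_exists.1 hd
    have hpe := hact.act_eq_of_mkY_eq (h.symm.trans hiy)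
    rw [hpe, hz, hact.obj_act_eq e y z he hz]
  · intro h
    have ht := hact.tgt_act h
    obtain ⟨hm, hiy⟩ := hi y (C.tgt p.1.1) (C.obj_tgt _) (by rw [ht]; rfl)
    have hp : eqvT C act p ⟨(C.tgt p.1.1, y), hm⟩ :=
      Relation.EqvGen.rel _ _ ⟨p.2, hm, Or.inl ⟨p.1.1, C.src_obj _ (C.obj_tgt _), y, h,
        (C.tgt_mul_self _).symm, rfl⟩⟩
    exact hiy.trans (Quot.sound hp).symm

/-- For a graph open continuous action, `{(g, x) : g·x ∈ U}` is open when `U` is. -/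
theorem IsContAction.isOpen_setOf_act_mem {M : Type u} {X : Type v} [TopologicalSpace M]
    [TopologicalSpace X] {C : PartialCat M} {act : M → X → Option X}
    (hcont : IsContAction C act) (hgraph : IsGraphOpen act) {U : Set X} (hU : IsOpen U) :
    IsOpen {p : M × X | ∃ y ∈ U, act p.1 p.2 = some y} := by
  convert hgraph.isOpenMap_subtype_val _ (hU.preimage hcont.2) using 1
  ext p
  constructor
  · rintro ⟨y, hy, h⟩
    exact ⟨⟨p, by simp [h]⟩, by simpa [h] using hy, rfl⟩
  · rintro ⟨⟨p, hp⟩, hmem, rfl⟩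
    exact ⟨_, hmem, (Option.some_get hp).symm⟩

/-- If the topological category `G` is star open and the
continuous partial action is graph open, then `i : X → Y = X̄/≃` is an open map. -/
theorem stmt17 {M X : Type u} [TopologicalSpace M] [TopologicalSpace X]
    (C : PartialCat M) (hcomp : ContComp C)
    (act : M → X → Option X) (hact : IsPartialCatAction C act)
    (hcont : IsContAction C act)
    (hstar : IsStarOpen C) (hgraph : IsGraphOpen act) :
    ∀ i : X → Yglob C act, ISpec C act i → IsOpenMap i := by
  intro i hi U hU
  refine isQuotientMap_quot_mk.isOpen_preimage.1 ?_
  convert (hcont.isOpen_setOf_act_mem hgraph hU).preimage continuous_subtype_val using 1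
  ext p
  exact exists_congr fun y => and_congr_right fun _ => hact.mkY_eq_iff hi p y
end

section
/- Every partial group action of a group G on a set X admits a universal globalization: there exist a set Y with a global action of G and a G-function i : X → Y such that for every set Z with a global action of G and every G-function j : X → Z there is a unique G-function k : Y → Z with j = k ∘ i. -/
universe u v w

/-- The relation on `G × X` identifying `(g * h, x)` with `(g, h · x)` whenever `h · x` is
defined. -/
def translateRel {G : Type u} {X : Type v} [Group G] (act : G → X → Option X)
    (p q : G × X) : Prop :=
  ∃ h : G, act h p.2 = some q.2 ∧ p.1 = q.1 * h

/-- The action of `G` on the quotient of `G × X` by `translateRel`, induced by left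
multiplication. -/
def Globalization.smul {G : Type u} {X : Type v} [Group G] (act : G → X → Option X) (g : G) :
    Quot (translateRel act) → Quot (translateRel act) :=
  Quot.map (fun p => (g * p.1, p.2)) fun _ _ ⟨h, hact, hmul⟩ =>
    ⟨h, hact, by simp only [hmul, mul_assoc]⟩

/-- Every partial group action on a set admits a universal
globalization.  A partial group action is encoded by `act : G → X → Option X`
satisfying (G1), (G2), (G3); a global action by a total action `actY` with the
identity and compatibility laws; `G`-functions as displayed. -/
theorem stmt18 {G X : Type u} [Group G] (act : G → X → Option X)
    (hG1 : ∀ x : X, act 1 x = some x)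
    (hG2 : ∀ (g : G) (x y : X), act g x = some y → act g⁻¹ y = some x)
    (hG3 : ∀ (g h : G) (x y z : X), act h x = some y → act g y = some z →
      act (g * h) x = some z) :
    ∃ (Y : Type u) (actY : G → Y → Y) (i : X → Y),
      (∀ y : Y, actY 1 y = y) ∧
      (∀ (g h : G) (y : Y), actY (g * h) y = actY g (actY h y)) ∧
      (∀ (g : G) (x y : X), act g x = some y → actY g (i x) = i y) ∧
      ∀ (Z : Type u) (actZ : G → Z → Z) (j : X → Z),
        (∀ z : Z, actZ 1 z = z) →
        (∀ (g h : G) (z : Z), actZ (g * h) z = actZ g (actZ h z)) →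
        (∀ (g : G) (x y : X), act g x = some y → actZ g (j x) = j y) →
        ∃! k : Y → Z, (∀ (g : G) (y : Y), k (actY g y) = actZ g (k y)) ∧ j = k ∘ i := by
  refine ⟨Quot (translateRel act), Globalization.smul act, fun x => Quot.mk _ (1, x),
    ?_, ?_, ?_, ?_⟩
  · rintro ⟨h, x⟩
    exact congrArg (fun a => Quot.mk _ (a, x)) (one_mul h)
  · rintro g h ⟨a, x⟩
    exact congrArg (fun b => Quot.mk _ (b, x)) (mul_assoc g h a)
  · intro g x y hxy
    exact Quot.sound ⟨g, hxy, by simp⟩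
  · intro Z actZ j hone hmul hj
    refine ⟨Quot.lift (fun p => actZ p.1 (j p.2)) ?_, ⟨?_, ?_⟩, ?_⟩
    · rintro ⟨a, x⟩ ⟨b, y⟩ ⟨h, hxy, hab⟩
      dsimp only at hxy hab ⊢
      rw [hab, hmul, hj h x y hxy]
    · rintro g ⟨a, x⟩
      exact hmul g a (j x)
    · funext x
      exact (hone (j x)).symm
    · rintro k ⟨hk, rfl⟩
      funext q
      obtain ⟨a, x⟩ := q
      have h := hk a (Quot.mk _ (1, x))
      simpa [Globalization.smul, Quot.map] using h
end
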